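/- Let ν > 0 and let h : ℝ → ℝ be Lipschitz-continuous. Then there exists a Lipschitz-continuous solution f_h on all of ℝ of the centered Gamma Stein equation 2(x+ν) f'(x) − x f(x) = h(x) − E[h(Z_ν)] which satisfies the bounds sup_{x∈ℝ}|f_h(x)| ≤ ‖h'‖ and ‖f_h'‖ ≤ max(1, 2/ν)·‖h'‖. -/

import Mathlib

open MeasureTheory ProbabilityTheory Real

/-- The minimum Lipschitz constant `‖g'‖ = sup_{x ≠ y} |g x - g y| / |x - y|` of `g : ℝ → ℝ`. -/
noncomputable def lipConst (g : ℝ → ℝ) : ℝ :=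
  sSup {c | ∃ x y : ℝ, x ≠ y ∧ c = |g x - g y| / |x - y|}

/-- The expectation `E[h(Z_ν)]` of `h` under the centered Gamma distribution `Γ̄(ν)`, the law of
`Z_ν = 2 X_{ν/2,1} − ν` where `X_{ν/2,1} ∼ Γ(ν/2, 1)`. -/
noncomputable def centeredGammaExp (ν : ℝ) (h : ℝ → ℝ) : ℝ :=
  ∫ x, h (2 * x - ν) ∂(gammaMeasure (ν / 2) 1)

noncomputable def steinG (a c : ℝ) (φ : ℝ → ℝ) (τ : ℝ) : ℝ :=
  (1/2) * τ^(-a) * exp (c*τ) * ∫ r in (0:ℝ)..τ, r^(a-1) * exp (-(c*r)) * φ r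

noncomputable def steinQ (a c : ℝ) (φ G : ℝ → ℝ) (x : ℝ) : ℝ :=
  x^a * exp (-(c*x)) * ((2*c*x - 2*a) * G x + φ x)

lemma steinII {a : ℝ} (ha : 0 < a) (c : ℝ) {φ : ℝ → ℝ} (hφ : Continuous φ) (x y : ℝ) :
    IntervalIntegrable (fun r : ℝ => r^(a-1) * exp (-(c*r)) * φ r) volume x y := by
  have h1 : IntervalIntegrable (fun r : ℝ => r^(a-1)) volume x y :=
    intervalIntegral.intervalIntegrable_rpow' (by linarith)
  have h2 : Continuous (fun r : ℝ => exp (-(c*r)) * φ r) := by fun_prop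
  have := h1.mul_continuousOn (h2.continuousOn (s := Set.uIcc x y))
  simpa [mul_assoc] using this

lemma steinG_deriv {a : ℝ} (ha : 0 < a) (c : ℝ) {φ : ℝ → ℝ} (hφ : Continuous φ) {τ : ℝ}
    (hτ : 0 < τ) :
    HasDerivAt (steinG a c φ) (((2*c*τ - 2*a) * steinG a c φ τ + φ τ) / (2*τ)) τ := by
  have hc : ContinuousAt (fun r : ℝ => r^(a-1) * exp (-(c*r)) * φ r) τ := by
    have : ContinuousAt (fun r : ℝ => r^(a-1)) τ :=
      Real.continuousAt_rpow_const _ _ (Or.inl hτ.ne')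
    exact (this.mul (by fun_prop)).mul hφ.continuousAt
  have hm : StronglyMeasurableAtFilter (fun r : ℝ => r^(a-1) * exp (-(c*r)) * φ r)
      (nhds τ) volume := by
    refine Measurable.stronglyMeasurable ?_ |>.stronglyMeasurableAtFilter
    have := hφ.measurable
    fun_prop
  have hI := intervalIntegral.integral_hasDerivAt_right (steinII ha c hφ 0 τ) hm hc
  have h1 : HasDerivAt (fun x : ℝ => x^(-a)) (-a * τ^(-a-1)) τ :=
    Real.hasDerivAt_rpow_const (Or.inl hτ.ne')
  have h2 : HasDerivAt (fun x : ℝ => exp (c*x)) (exp (c*τ) * (c*1)) τ :=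
    ((hasDerivAt_id τ).const_mul c).exp
  have := ((h1.const_mul (1/2)).mul h2).mul hI
  refine this.congr_deriv ?_
  simp only [steinG, Pi.mul_apply]
  generalize (∫ r in (0:ℝ)..τ, r^(a-1) * exp (-(c*r)) * φ r) = I
  have e1 : τ^(-a-1) = τ^(-a) / τ := by rw [Real.rpow_sub hτ, Real.rpow_one]
  have e2 : τ^(a-1) = (τ^(-a))⁻¹ / τ := by
    rw [Real.rpow_sub hτ, Real.rpow_one, Real.rpow_neg hτ.le, inv_inv]
  have e3 : exp (-(c*τ)) = (exp (c*τ))⁻¹ := Real.exp_neg _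
  rw [e1, e2, e3]
  have p1 : τ^(-a) ≠ 0 := (Real.rpow_pos_of_pos hτ _).ne'
  have p2 : exp (c*τ) ≠ 0 := (Real.exp_pos _).ne'
  field_simp
  ring

lemma steinQ_fwd {a c L : ℝ} {φ G : ℝ → ℝ} (hc : |2*c| ≤ 1)
    (hφc : Continuous φ) (hφ : ∀ x y, x ≤ y → φ y - φ x ≤ L * (y - x))
    (hG : ∀ x, 0 < x → HasDerivAt G (((2*c*x - 2*a) * G x + φ x) / (2*x)) x)
    (hGL : ∀ x, 0 < x → |G x| ≤ L) {B B' : ℝ → ℝ} {x0 x1 : ℝ} (h0 : 0 < x0) (h01 : x0 ≤ x1)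
    (hB : ∀ x, x0 ≤ x → x ≤ x1 → HasDerivAt B (B' x) x)
    (hB' : ∀ x, x0 ≤ x → x ≤ x1 → 2 * L * (x^a * exp (-(c*x))) ≤ B' x) :
    steinQ a c φ G x1 - steinQ a c φ G x0 ≤ B x1 - B x0 := by
  have hq : ∀ x : ℝ, 0 < x → HasDerivAt (fun x : ℝ => x^a * exp (-(c*x)))
      (x^a * exp (-(c*x)) * (a / x - c)) x := by
    intro x hx
    have h1 : HasDerivAt (fun x : ℝ => x^a) (a * x^(a-1)) x :=
      Real.hasDerivAt_rpow_const (Or.inl hx.ne')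
    have h2 : HasDerivAt (fun x : ℝ => exp (-(c*x))) (exp (-(c*x)) * (-(c*1))) x :=
      ((hasDerivAt_id x).const_mul c).neg.exp
    refine (h1.mul h2).congr_deriv ?_
    rw [Real.rpow_sub hx, Real.rpow_one]
    ring
  have key := @image_le_of_liminf_slope_right_le_deriv_boundary (steinQ a c φ G) x0 x1 ?_
    (fun x => B x + (steinQ a c φ G x0 - B x0)) B' (by simp) ?_ ?_ ?_ x1 ⟨h01, le_rfl⟩
  · linarith
  · intro x hx
    have hx0 : 0 < x := h0.trans_le hx.1
    have := ((hq x hx0).continuousAt.mul (((by fun_prop :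
      ContinuousAt (fun x : ℝ => 2*c*x - 2*a) x).mul (hG x hx0).continuousAt).add
        hφc.continuousAt))
    exact this.continuousWithinAt
  · intro x hx
    exact ((hB x hx.1 hx.2).add_const _).continuousAt.continuousWithinAt
  · intro x hx
    exact ((hB x hx.1 hx.2.le).add_const _).hasDerivWithinAt
  · intro x hx r hr
    have hx0 : 0 < x := h0.trans_le hx.1
    let F : ℝ → ℝ := fun z => (z^a * exp (-(c*z))) * ((2*c*z - 2*a) * G z + (φ x + L * (z - x)))
    have hFd : HasDerivAt F (x^a * exp (-(c*x)) * (2*c*G x + L)) x := by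
      have l1 : HasDerivAt (fun z : ℝ => 2*c*z - 2*a) (2*c*1) x :=
        ((hasDerivAt_id x).const_mul (2*c)).sub_const _
      have l2 : HasDerivAt (fun z : ℝ => φ x + L * (z - x)) (L*1) x :=
        (((hasDerivAt_id x).sub_const x).const_mul L).const_add _
      refine ((hq x hx0).mul ((l1.mul (hG x hx0)).add l2)).congr_deriv ?_
      simp only [Pi.add_apply, Pi.mul_apply]
      field_simp
      ring
    have hlt : x^a * exp (-(c*x)) * (2*c*G x + L) < r := by
      refine lt_of_le_of_lt ?_ hr
      refine le_trans ?_ (hB' x hx.1 hx.2.le)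
      have hqp : 0 ≤ x^a * exp (-(c*x)) := by positivity
      have : 2*c*G x ≤ L := by
        calc 2*c*G x ≤ |2*c*G x| := le_abs_self _
          _ = |2*c| * |G x| := abs_mul _ _
          _ ≤ 1 * |G x| := by gcongr
          _ ≤ L := by simpa using hGL x hx0
      nlinarith
    have ht := hasDerivWithinAt_iff_tendsto_slope.1 (hFd.hasDerivWithinAt (s := Set.Ioi x))
    have hev : ∀ᶠ z in nhdsWithin x (Set.Ioi x), slope F x z < r := by
      have h' := ht.eventually (gt_mem_nhds hlt)
      have hs : Set.Ioi x \ {x} = Set.Ioi x := by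
        ext z; simp
      rwa [hs] at h'
    have hev2 : ∀ᶠ z in nhdsWithin x (Set.Ioi x), slope (steinQ a c φ G) x z < r := by
      filter_upwards [hev, self_mem_nhdsWithin] with z hz hzx
      have hzx : x < z := hzx
      refine lt_of_le_of_lt ?_ hz
      rw [slope_def_field, slope_def_field]
      have : 0 < z - x := by linarith
      have hFx : F x = steinQ a c φ G x := by simp [F, steinQ]
      have hFz : steinQ a c φ G z ≤ F z := by
        simp only [F, steinQ]
        have hz0 : 0 < z := hx0.trans hzx
        have := hφ x z hzx.le
        gcongr
        linarith
      rw [hFx]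
      gcongr
    exact hev2.frequently

lemma steinQ_low {a c L : ℝ} {φ G : ℝ → ℝ} (ha : 0 < a) (hc : |2*c| ≤ 1)
    (hφc : Continuous φ) (hφ : ∀ x y, x ≤ y → φ y - φ x ≤ L * (y - x)) (hL : 0 ≤ L)
    (hG : ∀ x, 0 < x → HasDerivAt G (((2*c*x - 2*a) * G x + φ x) / (2*x)) x)
    (hGL : ∀ x, 0 < x → |G x| ≤ L) {B B' : ℝ → ℝ} {x1 : ℝ} (h1 : 0 < x1)
    (hB : ∀ x, 0 < x → x ≤ x1 → HasDerivAt B (B' x) x)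
    (hB0 : ∀ x, 0 < x → x ≤ x1 → 0 ≤ B x)
    (hB' : ∀ x, 0 < x → x ≤ x1 → (x^a * exp (-(c*x))) ≤ B' x) :
    steinQ a c φ G x1 ≤ 2 * L * B x1 := by
  have hlim : Filter.Tendsto (fun x : ℝ => (x^a * exp (-(c*x))) *
      (|2*c*x-2*a| * L + |φ x|)) (nhdsWithin 0 (Set.Ioi 0)) (nhds 0) := by
    have : ContinuousAt (fun x : ℝ => (x^a * exp (-(c*x))) *
      (|2*c*x-2*a| * L + |φ x|)) 0 := by
      have h1 : ContinuousAt (fun x : ℝ => x^a) 0 :=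
        Real.continuousAt_rpow_const _ _ (Or.inr ha.le)
      exact (h1.mul (by fun_prop)).mul (by fun_prop)
    have h2 := this.tendsto
    simp only [Real.zero_rpow ha.ne', zero_mul] at h2
    exact h2.mono_left nhdsWithin_le_nhds
  have : ∀ᶠ x in nhdsWithin (0:ℝ) (Set.Ioi 0), steinQ a c φ G x1 - 2 * L * B x1 ≤
      (x^a * exp (-(c*x))) * (|2*c*x-2*a| * L + |φ x|) := by
    filter_upwards [self_mem_nhdsWithin, nhdsWithin_le_nhds (Iic_mem_nhds h1)] with x hx hx1
    have hx : 0 < x := hx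
    have hx1 : x ≤ x1 := hx1
    have := steinQ_fwd (a := a) hc hφc hφ hG hGL (B := fun x => 2 * L * B x)
      (B' := fun x => 2 * L * B' x) hx hx1
      (fun y hy hy1 => (hB y (hx.trans_le hy) hy1).const_mul _)
      (fun y hy hy1 => by
        have := hB' y (hx.trans_le hy) hy1
        gcongr)
    have h3 : 0 ≤ 2 * L * B x := mul_nonneg (by positivity) (hB0 x hx hx1)
    have h4 : steinQ a c φ G x ≤ (x^a * exp (-(c*x))) * (|2*c*x-2*a| * L + |φ x|) := by
      simp only [steinQ]
      have t1 : (2*c*x-2*a) * G x ≤ |2*c*x-2*a| * L := by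
        calc (2*c*x-2*a) * G x ≤ |(2*c*x-2*a) * G x| := le_abs_self _
          _ = |2*c*x-2*a| * |G x| := abs_mul _ _
          _ ≤ |2*c*x-2*a| * L := by gcongr; exact hGL x hx
      have t2 := le_abs_self (φ x)
      exact mul_le_mul_of_nonneg_left (add_le_add t1 t2) (by positivity)
    linarith
  have := ge_of_tendsto hlim this
  linarith

lemma steinQ_high {a L : ℝ} {φ G : ℝ → ℝ} (ha : 0 < a)
    (hφc : Continuous φ) (hφ : ∀ x y, x ≤ y → φ y - φ x ≤ L * (y - x)) (hL : 0 ≤ L)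
    (hG : ∀ x, 0 < x → HasDerivAt G (((2*(1/2)*x - 2*a) * G x + φ x) / (2*x)) x)
    (hφ' : ∀ x y, x ≤ y → - (L * (y - x)) ≤ φ y - φ x)
    (hGL : ∀ x, 0 < x → |G x| ≤ L) {B B' : ℝ → ℝ} {x1 : ℝ} (h1 : 0 < x1)
    (hB : ∀ x, x1 ≤ x → HasDerivAt B (B' x) x)
    (hB0 : ∀ x, x1 ≤ x → 0 ≤ B x)
    (hB' : ∀ x, x1 ≤ x → (x^a * exp (-(1/2*x))) ≤ - B' x) :
    - (2 * L * B x1) ≤ steinQ a (1/2) φ G x1 := by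
  have hlim : Filter.Tendsto (fun x : ℝ => -((2 * L) * (x^(a+1) * exp (-(1/2)*x)) +
      (2*a*L+|φ 0|) * (x^a * exp (-(1/2)*x))))  Filter.atTop (nhds 0) := by
    have h1 := tendsto_rpow_mul_exp_neg_mul_atTop_nhds_zero (a+1) (1/2) (by norm_num)
    have h2 := tendsto_rpow_mul_exp_neg_mul_atTop_nhds_zero a (1/2) (by norm_num)
    simpa using ((h1.const_mul (2*L)).add (h2.const_mul (2*a*L+|φ 0|))).neg
  have : ∀ᶠ x in Filter.atTop, -((2 * L) * (x^(a+1) * exp (-(1/2)*x)) +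
      (2*a*L+|φ 0|) * (x^a * exp (-(1/2)*x))) ≤ steinQ a (1/2) φ G x1 + 2 * L * B x1 := by
    filter_upwards [Filter.eventually_ge_atTop x1] with x hx1
    have hx : 0 < x := h1.trans_le hx1
    have := steinQ_fwd (a := a) (c := 1/2) (by norm_num) hφc hφ hG hGL
      (B := fun x => - (2 * L * B x))
      (B' := fun x => - (2 * L * B' x)) h1 hx1
      (fun y hy hy1 => ((hB y hy).const_mul _).neg)
      (fun y hy hy1 => by
        have := mul_le_mul_of_nonneg_left (hB' y hy) (by positivity : 0 ≤ 2 * L)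
        linarith)
    have h3 : 0 ≤ 2 * L * B x := mul_nonneg (by positivity) (hB0 x hx1)
    have h4 : -((2 * L) * (x^(a+1) * exp (-(1/2)*x)) +
      (2*a*L+|φ 0|) * (x^a * exp (-(1/2)*x))) ≤ steinQ a (1/2) φ G x := by
      simp only [steinQ]
      rw [Real.rpow_add_one hx.ne']
      have e : exp (-(1/2)*x) = exp (-(1/2*x)) := by congr 1; ring
      rw [e]
      have hq : 0 ≤ x^a * exp (-(1/2*x)) := by positivity
      have a1 := hφ' 0 x hx.le
      have a2 := neg_abs_le (φ 0)
      have a3 := abs_le.1 (hGL x hx)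
      have : -(2 * L * x + (2*a*L + |φ 0|)) ≤ (2 * (1/2) * x - 2*a) * G x + φ x := by
        nlinarith [mul_nonneg hx.le (by linarith [a3.1] : 0 ≤ G x + L),
          mul_nonneg ha.le (by linarith [a3.2] : 0 ≤ L - G x)]
      nlinarith [mul_le_mul_of_nonneg_left this hq]
    linarith
  have := le_of_tendsto hlim this
  linarith

lemma steinQ_neg (a c : ℝ) (φ G : ℝ → ℝ) (x : ℝ) :
    steinQ a c (fun x => - φ x) (fun x => - G x) x = - steinQ a c φ G x := by
  simp only [steinQ]; ring

lemma steinOde_neg {a c : ℝ} {φ G : ℝ → ℝ}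
    (hG : ∀ x, 0 < x → HasDerivAt G (((2*c*x - 2*a) * G x + φ x) / (2*x)) x) :
    ∀ x, 0 < x → HasDerivAt (fun x => - G x) (((2*c*x - 2*a) * (- G x) + (- φ x)) / (2*x)) x := by
  intro x hx
  exact (hG x hx).neg.congr_deriv (by ring)

lemma steinQ_low_abs {a c L : ℝ} {φ G : ℝ → ℝ} (ha : 0 < a) (hc : |2*c| ≤ 1)
    (hφc : Continuous φ) (hφ : ∀ x y, |φ y - φ x| ≤ L * |y - x|) (hL : 0 ≤ L)
    (hG : ∀ x, 0 < x → HasDerivAt G (((2*c*x - 2*a) * G x + φ x) / (2*x)) x)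
    (hGL : ∀ x, 0 < x → |G x| ≤ L) {B B' : ℝ → ℝ} {x1 : ℝ} (h1 : 0 < x1)
    (hB : ∀ x, 0 < x → x ≤ x1 → HasDerivAt B (B' x) x)
    (hB0 : ∀ x, 0 < x → x ≤ x1 → 0 ≤ B x)
    (hB' : ∀ x, 0 < x → x ≤ x1 → (x^a * exp (-(c*x))) ≤ B' x) :
    |steinQ a c φ G x1| ≤ 2 * L * B x1 := by
  have p1 : ∀ x y, x ≤ y → φ y - φ x ≤ L * (y - x) := fun x y hxy => by
    have := (abs_le.1 (hφ x y)).2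
    rwa [abs_of_nonneg (sub_nonneg.2 hxy)] at this
  have p2 : ∀ x y, x ≤ y → (- φ y) - (- φ x) ≤ L * (y - x) := fun x y hxy => by
    have := (abs_le.1 (hφ x y)).1
    rw [abs_of_nonneg (sub_nonneg.2 hxy)] at this
    linarith
  have h1' := steinQ_low ha hc hφc p1 hL hG hGL h1 hB hB0 hB'
  have h2' := steinQ_low (φ := fun x => - φ x) ha hc hφc.neg p2 hL (steinOde_neg hG) (by simpa using hGL) h1 hB hB0 hB'
  rw [steinQ_neg] at h2'
  exact abs_le.2 ⟨by linarith, h1'⟩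

lemma steinQ_high_abs {a L : ℝ} {φ G : ℝ → ℝ} (ha : 0 < a)
    (hφc : Continuous φ) (hφ : ∀ x y, |φ y - φ x| ≤ L * |y - x|) (hL : 0 ≤ L)
    (hG : ∀ x, 0 < x → HasDerivAt G (((2*(1/2)*x - 2*a) * G x + φ x) / (2*x)) x)
    (hGL : ∀ x, 0 < x → |G x| ≤ L) {B B' : ℝ → ℝ} {x1 : ℝ} (h1 : 0 < x1)
    (hB : ∀ x, x1 ≤ x → HasDerivAt B (B' x) x)
    (hB0 : ∀ x, x1 ≤ x → 0 ≤ B x)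
    (hB' : ∀ x, x1 ≤ x → (x^a * exp (-(1/2*x))) ≤ - B' x) :
    |steinQ a (1/2) φ G x1| ≤ 2 * L * B x1 := by
  have p1 : ∀ x y, x ≤ y → φ y - φ x ≤ L * (y - x) := fun x y hxy => by
    have := (abs_le.1 (hφ x y)).2
    rwa [abs_of_nonneg (sub_nonneg.2 hxy)] at this
  have p2 : ∀ x y, x ≤ y → - (L * (y - x)) ≤ φ y - φ x := fun x y hxy => by
    have := (abs_le.1 (hφ x y)).1
    rwa [abs_of_nonneg (sub_nonneg.2 hxy)] at this
  have h1' := steinQ_high ha hφc p1 hL hG p2 hGL h1 hB hB0 hB'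
  have h2' := steinQ_high (φ := fun x => - φ x) ha hφc.neg (fun x y hxy => by linarith [p2 x y hxy]) hL
    (steinOde_neg hG) (fun x y hxy => by linarith [p1 x y hxy]) (by simpa using hGL) h1 hB hB0 hB'
  rw [steinQ_neg] at h2'
  exact abs_le.2 ⟨by linarith, by linarith⟩

lemma steinB_deriv (a c : ℝ) {w w' : ℝ → ℝ} {x : ℝ} (hx : 0 < x) (hw : HasDerivAt w (w' x) x) :
    HasDerivAt (fun x : ℝ => x^(a+1) * exp (-(c*x)) * w x)
      (x^a * exp (-(c*x)) * ((a + 1 - c * x) * w x + x * w' x)) x := by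
  have h1 : HasDerivAt (fun x : ℝ => x^(a+1)) ((a+1) * x^(a+1-1)) x :=
    Real.hasDerivAt_rpow_const (Or.inl hx.ne')
  have h2 : HasDerivAt (fun x : ℝ => exp (-(c*x))) (exp (-(c*x)) * (-(c*1))) x :=
    ((hasDerivAt_id x).const_mul c).neg.exp
  refine ((h1.mul h2).mul hw).congr_deriv ?_
  simp only [add_sub_cancel_right, Pi.mul_apply]
  rw [Real.rpow_add_one hx.ne']
  ring

lemma steinR_of_Q {a c L M w : ℝ} {φ G : ℝ → ℝ} {x : ℝ} (hx : 0 < x) (hL : 0 ≤ L) (hw : w ≤ M)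
    (h : |steinQ a c φ G x| ≤ 2 * L * (x^(a+1) * exp (-(c*x)) * w)) :
    |(2*c*x - 2*a) * G x + φ x| ≤ 2 * x * (M * L) := by
  have hq : 0 < x^a * exp (-(c*x)) := by positivity
  rw [steinQ, abs_mul, abs_of_pos hq, Real.rpow_add_one hx.ne'] at h
  have h2 : (x^a * exp (-(c*x))) * |(2*c*x - 2*a) * G x + φ x| ≤
      (x^a * exp (-(c*x))) * (2 * x * (w * L)) := by
    refine h.trans (le_of_eq ?_); ring
  refine (le_of_mul_le_mul_left h2 hq).trans ?_
  gcongr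

lemma steinR_neg {a L : ℝ} {φ G : ℝ → ℝ} (ha : 0 < a)
    (hφc : Continuous φ) (hφ : ∀ x y, |φ y - φ x| ≤ L * |y - x|) (hL : 0 ≤ L)
    (hG : ∀ x, 0 < x → HasDerivAt G (((2*(-1/2)*x - 2*a) * G x + φ x) / (2*x)) x)
    (hGL : ∀ x, 0 < x → |G x| ≤ L) {M : ℝ} (hM : 1 ≤ M) {x : ℝ} (hx : 0 < x) :
    |(2*(-1/2)*x - 2*a) * G x + φ x| ≤ 2 * x * (M * L) := by
  refine steinR_of_Q hx hL hM (steinQ_low_abs ha (c := -1/2)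
    (B := fun y => y^(a+1) * exp (-(-1/2*y)) * 1)
    (B' := fun y => y^a * exp (-(-1/2*y)) * ((a + 1 - (-1/2)*y) * 1 + y * 0))
    (by norm_num) hφc hφ hL hG hGL hx
    (fun y hy _ => steinB_deriv a (-1/2) (w := fun _ => 1) (w' := fun _ => 0) hy
      (hasDerivAt_const y (1:ℝ)))
    (fun y hy _ => by positivity) (fun y hy _ => ?_))
  have hq : 0 < y^a * exp (-(-1/2*y)) := by positivity
  apply le_mul_of_one_le_right hq.le
  linarith

lemma steinR_pos {a L : ℝ} {φ G : ℝ → ℝ} (ha : 0 < a)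
    (hφc : Continuous φ) (hφ : ∀ x y, |φ y - φ x| ≤ L * |y - x|) (hL : 0 ≤ L)
    (hG : ∀ x, 0 < x → HasDerivAt G (((2*(1/2)*x - 2*a) * G x + φ x) / (2*x)) x)
    (hGL : ∀ x, 0 < x → |G x| ≤ L) {m : ℝ} (hm : 0 < m) (hm1 : m ≤ 1) (hma : m ≤ a)
    {x : ℝ} (hx : 0 < x) :
    |(2*(1/2)*x - 2*a) * G x + φ x| ≤ 2 * x * (1/m * L) := by
  rcases le_total (1/2*x) (a + 2/3*m) with hxs | hxs
  · have hD : ∀ y, y ≤ x → 6*m ≤ 8*m+3*a-3/2*y := fun y hy => by linarith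
    refine steinR_of_Q (w := 6/(8*m+3*a-3/2*x)) hx hL ?_ (steinQ_low_abs ha (c := 1/2)
      (B' := fun y => y^a * exp (-(1/2*y)) * ((a + 1 - 1/2*y) * (6/(8*m+3*a-3/2*y)) +
        y * (9/(8*m+3*a-3/2*y)^2)))
      (B := fun y => y^(a+1) * exp (-(1/2*y)) * (6/(8*m+3*a-3/2*y)))
      (by norm_num) hφc hφ hL hG hGL hx
      (fun y hy hyx => steinB_deriv a (1/2) (w := fun y => 6/(8*m+3*a-3/2*y))
        (w' := fun y => 9/(8*m+3*a-3/2*y)^2) hy ?_)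
      (fun y hy hyx => ?_) (fun y hy hyx => ?_))
    · have := hD x le_rfl
      rw [div_le_div_iff₀ (by linarith) hm]
      linarith
    · have h0 : 8*m+3*a-3/2*y ≠ 0 := by have := hD y hyx; linarith
      have h1 : HasDerivAt (fun y : ℝ => 8*m+3*a-3/2*y) (-(3/2*1)) y :=
        ((hasDerivAt_id y).const_mul (3/2)).const_sub _
      refine ((hasDerivAt_const y (6:ℝ)).div h1 h0).congr_deriv ?_
      ring
    · have := hD y hyx
      have : 0 < 8*m+3*a-3/2*y := by linarith
      positivity
    · have := hD y hyx
      have hD0 : 0 < 8*m+3*a-3/2*y := by linarith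
      have hq : 0 < y^a * exp (-(1/2*y)) := by positivity
      apply le_mul_of_one_le_right hq.le
      have : (a + 1 - 1/2*y) * (6/(8*m+3*a-3/2*y)) + y * (9/(8*m+3*a-3/2*y)^2) =
        ((a + 1 - 1/2*y) * 6 * (8*m+3*a-3/2*y) + 9 * y) / (8*m+3*a-3/2*y)^2 := by
        field_simp
      rw [this, one_le_div (by positivity)]
      nlinarith [sq_nonneg (a - 1/2*y), mul_nonneg hm.le (sub_nonneg.2 hm1)]
  · have hz : ∀ y, x ≤ y → 5/3*m ≤ 1/2*y-a+m := fun y hy => by linarith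
    refine steinR_of_Q (w := 1/(1/2*x-a+m) + m/(1/2*x-a+m)^2) hx hL ?_ (steinQ_high_abs ha
      (B' := fun y => y^a * exp (-(1/2*y)) * ((a + 1 - 1/2*y) *
        (1/(1/2*y-a+m) + m/(1/2*y-a+m)^2) +
        y * (-(1/2)/(1/2*y-a+m)^2 - m/(1/2*y-a+m)^3)))
      (B := fun y => y^(a+1) * exp (-(1/2*y)) * (1/(1/2*y-a+m) + m/(1/2*y-a+m)^2))
      hφc hφ hL hG hGL hx
      (fun y hyx => steinB_deriv a (1/2) (w := fun y => 1/(1/2*y-a+m) + m/(1/2*y-a+m)^2)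
        (w' := fun y => -(1/2)/(1/2*y-a+m)^2 - m/(1/2*y-a+m)^3) (hx.trans_le hyx) ?_)
      (fun y hyx => ?_) (fun y hyx => ?_))
    · have := hz x le_rfl
      have h0 : 0 < 1/2*x-a+m := by linarith
      generalize 1/2*x-a+m = z at *
      have : 1/z + m/z^2 = (z + m)/z^2 := by field_simp
      rw [this, div_le_div_iff₀ (by positivity) hm]
      nlinarith
    · have h0 : 1/2*y-a+m ≠ 0 := by have := hz y hyx; linarith
      have h1 : HasDerivAt (fun y : ℝ => 1/2*y-a+m) (1/2*1) y :=
        (((hasDerivAt_id y).const_mul (1/2)).sub_const _).add_const _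
      refine (((hasDerivAt_const y (1:ℝ)).div h1 h0).add
        ((hasDerivAt_const y m).div (h1.pow 2) (pow_ne_zero 2 h0))).congr_deriv ?_
      simp only [Pi.pow_apply]
      clear h1
      generalize 1/2*y-a+m = z at *
      field_simp
      ring
    · have := hz y hyx
      have : 0 < 1/2*y-a+m := by linarith
      have := hx.trans_le hyx
      positivity
    · have hz1 := hz y hyx
      have hy0 := hx.trans_le hyx
      have hq : 0 < y^a * exp (-(1/2*y)) := by positivity
      rw [← mul_neg (y^a * exp (-(1/2*y)))]
      apply le_mul_of_one_le_right hq.le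
      obtain ⟨z, hzd⟩ : ∃ z, z = 1/2*y-a+m := ⟨_, rfl⟩
      rw [← hzd] at hz1 ⊢
      have hz0 : 0 < z := by linarith
      have hy : y = 2*(z+a-m) := by linarith
      have : -((a + 1 - 1/2*y) * (1/z + m/z^2) + y * (-(1/2)/z^2 - m/z^3)) =
        (-((a + 1 - 1/2*y) * (z^2 + m * z)) + y * (1/2*z + m))/z^3 := by
        field_simp; ring
      rw [this, one_le_div (by positivity), hy]
      nlinarith [mul_nonneg hz0.le (mul_nonneg hm.le (sub_nonneg.2 hm1)),
        mul_nonneg (sub_nonneg.2 hma) hz0.le, mul_nonneg (sub_nonneg.2 hma) hm.le]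

lemma stein_glue {a c L C : ℝ} {φ G : ℝ → ℝ} (ha : 0 < a) (hφc : Continuous φ)
    (hG : ∀ x, 0 < x → HasDerivAt G (((2*c*x - 2*a) * G x + φ x) / (2*x)) x)
    (hGL : ∀ x, 0 < x → |G x| ≤ L)
    (hR : ∀ x, 0 < x → |(2*c*x - 2*a) * G x + φ x| ≤ 2 * x * C) :
    (∀ x y, 0 < x → 0 < y → |G x - G y| ≤ C * |x - y|) ∧
    (∀ x, 0 < x → |G x - φ 0 / (2*a)| ≤ C * x) := by
  have h1 : ∀ x y, 0 < x → 0 < y → |G x - G y| ≤ C * |x - y| := by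
    intro x y hx hy
    have := (convex_Ioi (0:ℝ)).norm_image_sub_le_of_norm_hasDerivWithin_le (f := G) (C := C)
      (f' := fun x => ((2*c*x - 2*a) * G x + φ x) / (2*x))
      (fun x hx => (hG x hx).hasDerivWithinAt) (fun x hx => by
        have hx : 0 < x := hx
        rw [Real.norm_eq_abs, abs_div, abs_of_pos (by positivity : 0 < 2*x),
          div_le_iff₀ (by positivity)]
        linarith [hR x hx]) (Set.mem_Ioi.2 hy) (Set.mem_Ioi.2 hx)
    simpa [Real.norm_eq_abs] using this
  have hC : 0 ≤ C := by
    have := (abs_nonneg _).trans (hR 1 one_pos)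
    linarith
  refine ⟨h1, fun x hx => ?_⟩
  have hlim : Filter.Tendsto (fun y : ℝ => C * x + (|φ y - φ 0| + 2*y*C + |2*c| * y * L)/(2*a))
      (nhdsWithin 0 (Set.Ioi 0)) (nhds (C * x)) := by
    have h : Continuous (fun y : ℝ => C * x + (|φ y - φ 0| + 2*y*C + |2*c| * y * L)/(2*a)) := by
      fun_prop
    have h2 := h.tendsto 0
    simp only [sub_self, abs_zero, mul_zero, zero_mul, add_zero, zero_div] at h2
    exact h2.mono_left nhdsWithin_le_nhds
  refine ge_of_tendsto hlim ?_
  filter_upwards [self_mem_nhdsWithin, nhdsWithin_le_nhds (Iic_mem_nhds hx)] with y hy hyx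
  have hy : 0 < y := hy
  have hyx : y ≤ x := hyx
  have e1 := h1 x y hx hy
  rw [abs_of_nonneg (sub_nonneg.2 hyx)] at e1
  have e2 : |G y - φ 0 / (2*a)| ≤ (|φ y - φ 0| + 2*y*C + |2*c| * y * L)/(2*a) := by
    have : G y - φ 0 / (2*a) = ((φ y - φ 0) - ((2*c*y - 2*a) * G y + φ y) + 2*c*y*G y)/(2*a) := by
      field_simp; ring
    rw [this, abs_div, abs_of_pos (by positivity : 0 < 2*a)]
    gcongr
    refine (abs_add_le _ _).trans (add_le_add ((abs_sub _ _).trans (add_le_add le_rfl (hR y hy))) ?_)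
    rw [abs_mul, abs_mul (2*c) y, abs_of_pos hy]
    gcongr
    exact hGL y hy
  have e3 := abs_sub_le (G x) (G y) (φ 0 / (2*a))
  nlinarith [mul_nonneg hC hy.le]

lemma stein_lin {a : ℝ} (ha : 0 < a) (c : ℝ) {τ : ℝ} (hτ : 0 < τ) :
    ∫ r in (0:ℝ)..τ, r^(a-1) * exp (-(c*r)) * (2*c*r - 2*a) = - (2 * (τ^a * exp (-(c*τ)))) := by
  have := intervalIntegral.integral_eq_sub_of_hasDerivAt_of_le (a := 0) (b := τ)
    (f := fun x : ℝ => -(2 * (x^a * exp (-(c*x)))))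
    (f' := fun r => r^(a-1) * exp (-(c*r)) * (2*c*r - 2*a)) hτ.le ?_ ?_
    (steinII ha c (by fun_prop) 0 τ)
  · rw [this]; simp [Real.zero_rpow ha.ne']
  · have h1 : Continuous (fun x : ℝ => x^a) := Real.continuous_rpow_const ha.le
    exact Continuous.continuousOn (by fun_prop)
  · intro x hx
    have h1 : HasDerivAt (fun x : ℝ => x^a) (a * x^(a-1)) x :=
      Real.hasDerivAt_rpow_const (Or.inl hx.1.ne')
    have h2 : HasDerivAt (fun x : ℝ => exp (-(c*x))) (exp (-(c*x)) * (-(c*1))) x :=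
      ((hasDerivAt_id x).const_mul c).neg.exp
    refine (((h1.mul h2).const_mul 2).neg).congr_deriv ?_
    have : x^a = x^(a-1) * x := by
      rw [← Real.rpow_add_one hx.1.ne']; congr 1; ring
    rw [this]; ring

lemma steinG_le {a : ℝ} (ha : 0 < a) (c : ℝ) {φ : ℝ → ℝ} (hφc : Continuous φ) {L τ : ℝ} (hτ : 0 < τ)
    (h : ∫ r in (0:ℝ)..τ, r^(a-1) * exp (-(c*r)) * (φ r + L * (2*c*r - 2*a)) ≤ 0) :
    steinG a c φ τ ≤ L := by
  have e : ∫ r in (0:ℝ)..τ, r^(a-1) * exp (-(c*r)) * (φ r + L * (2*c*r - 2*a)) =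
      (∫ r in (0:ℝ)..τ, r^(a-1) * exp (-(c*r)) * φ r) - L * (2 * (τ^a * exp (-(c*τ)))) := by
    have : ∀ r : ℝ, r^(a-1) * exp (-(c*r)) * (φ r + L * (2*c*r - 2*a)) =
      r^(a-1) * exp (-(c*r)) * φ r + L * (r^(a-1) * exp (-(c*r)) * (2*c*r - 2*a)) := by
      intro r; ring
    simp_rw [this]
    rw [intervalIntegral.integral_add (steinII ha c hφc 0 τ)
      ((steinII ha c (by fun_prop) 0 τ).const_mul L), intervalIntegral.integral_const_mul,
      stein_lin ha c hτ]
    ring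
  rw [e] at h
  have hp : 0 ≤ (1/2) * τ^(-a) * exp (c*τ) := by positivity
  calc steinG a c φ τ ≤ (1/2) * τ^(-a) * exp (c*τ) * (L * (2 * (τ^a * exp (-(c*τ))))) := by
        unfold steinG
        exact mul_le_mul_of_nonneg_left (by linarith) hp
    _ = L := by
        rw [Real.rpow_neg hτ.le, Real.exp_neg]
        have p1 : τ^a ≠ 0 := (Real.rpow_pos_of_pos hτ _).ne'
        have p2 : exp (c*τ) ≠ 0 := (Real.exp_pos _).ne'
        field_simp

lemma stein_integrable {a : ℝ} (ha : 0 < a) {φ : ℝ → ℝ} (hφc : Continuous φ) {L : ℝ}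
    (hφ : ∀ x y, |φ y - φ x| ≤ L * |y - x|) :
    IntegrableOn (fun r : ℝ => r^(a-1) * exp (-(1/2*r)) * φ r) (Set.Ioi 0) := by
  have i1 := integrableOn_rpow_mul_exp_neg_mul_rpow (s := a-1) (p := 1) (b := 1/2)
    (by linarith) one_pos (by norm_num)
  have i2 := integrableOn_rpow_mul_exp_neg_mul_rpow (s := a) (p := 1) (b := 1/2)
    (by linarith) one_pos (by norm_num)
  refine Integrable.mono' ((i1.const_mul (|φ 0|)).add (i2.const_mul L)) ?_ ?_
  · have := hφc.measurable
    exact (by fun_prop : Measurable (fun r : ℝ => r^(a-1) * exp (-(1/2*r)) * φ r)).aestronglyMeasurable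
  · refine (ae_restrict_iff' measurableSet_Ioi).2 (Filter.Eventually.of_forall fun r hr => ?_)
    have hr : 0 < r := hr
    have hp : 0 < r^(a-1) * exp (-(1/2*r)) := by positivity
    have e1 : r^a = r^(a-1) * r := by
      rw [← Real.rpow_add_one hr.ne']; congr 1; ring
    have e2 : exp (-(1/2) * r^(1:ℝ)) = exp (-(1/2*r)) := by rw [Real.rpow_one]; congr 1; ring
    have h1 := hφ 0 r
    rw [sub_zero, abs_of_pos hr] at h1
    have h2 : |φ r| ≤ |φ 0| + L * r := by
      have := abs_sub_abs_le_abs_sub (φ r) (φ 0)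
      linarith
    simp only [Pi.add_apply, e1, e2]
    rw [Real.norm_eq_abs, abs_mul, abs_of_pos hp]
    nlinarith [mul_le_mul_of_nonneg_left h2 hp.le]

lemma stein_lin_zero {a : ℝ} (ha : 0 < a) :
    ∫ r in Set.Ioi (0:ℝ), r^(a-1) * exp (-(1/2*r)) * (2*(1/2)*r - 2*a) = 0 := by
  have hi := stein_integrable ha (φ := fun r => 2*(1/2)*r - 2*a) (by fun_prop) (L := 1)
    (fun x y => by
      have : 2*(1/2)*y - 2*a - (2*(1/2)*x - 2*a) = y - x := by ring
      rw [this]; simp)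
  have t1 := intervalIntegral_tendsto_integral_Ioi 0 hi Filter.tendsto_id
  have t2 : Filter.Tendsto (fun τ : ℝ => - (2 * (τ^a * exp (-(1/2)*τ)))) Filter.atTop (nhds 0) := by
    have := tendsto_rpow_mul_exp_neg_mul_atTop_nhds_zero a (1/2) (by norm_num)
    simpa using (this.const_mul 2).neg
  refine tendsto_nhds_unique t1 (t2.congr' ?_)
  filter_upwards [Filter.eventually_gt_atTop 0] with τ hτ
  rw [id, stein_lin ha (1/2) hτ]
  congr 4; ring

lemma stein_mean {ν : ℝ} (hν : 0 < ν) (h : ℝ → ℝ) :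
    ∫ r in Set.Ioi (0:ℝ), r^(ν/2-1) * exp (-(1/2*r)) * h (r - ν) =
      centeredGammaExp ν h * ∫ r in Set.Ioi (0:ℝ), r^(ν/2-1) * exp (-(1/2*r)) := by
  have ha : 0 < ν/2 := by positivity
  have hΓ := Real.Gamma_pos_of_pos ha
  rw [Real.integral_rpow_mul_exp_neg_mul_Ioi ha (by norm_num : (0:ℝ) < 1/2)]
  have hE : centeredGammaExp ν h =
      ∫ x in Set.Ioi (0:ℝ), 1 / Real.Gamma (ν/2) * x^(ν/2-1) * exp (-x) * h (2*x-ν) := by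
    unfold centeredGammaExp gammaMeasure
    rw [integral_withDensity_eq_integral_toReal_smul
      (by unfold gammaPDF; fun_prop) (Filter.Eventually.of_forall fun x => by simp [gammaPDF]),
      ← integral_Ici_eq_integral_Ioi, ← integral_indicator measurableSet_Ici]
    congr 1
    ext x
    rw [gammaPDF, ENNReal.toReal_ofReal (gammaPDFReal_nonneg ha one_pos x), gammaPDFReal]
    by_cases hx : 0 ≤ x
    · simp [hx, Set.indicator]
    · simp [hx, Set.indicator]
  have hs := integral_comp_mul_left_Ioi
    (fun r : ℝ => r^(ν/2-1) * exp (-(1/2*r)) * h (r - ν)) 0 (two_pos : (0:ℝ) < 2)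
  have hl : ∫ x in Set.Ioi (0:ℝ), (2*x)^(ν/2-1) * exp (-(1/2*(2*x))) * h (2*x - ν) =
      2^(ν/2-1) * Real.Gamma (ν/2) * centeredGammaExp ν h := by
    rw [hE, ← integral_const_mul]
    refine setIntegral_congr_fun measurableSet_Ioi fun x hx => ?_
    have hx : 0 < x := hx
    have : -(1/2*(2*x)) = -x := by ring
    simp only [this]
    rw [Real.mul_rpow (by norm_num) hx.le]
    field_simp
  rw [hl, mul_zero, smul_eq_mul, Real.rpow_sub two_pos, Real.rpow_one] at hs
  have : (1/(1/2) : ℝ) = 2 := by norm_num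
  rw [this]
  linarith

lemma stein_mono_nonpos {a : ℝ} (ha : 0 < a) {K : ℝ → ℝ} (hK : Monotone K)
    (hi : IntegrableOn (fun r : ℝ => r^(a-1) * exp (-(1/2*r)) * K r) (Set.Ioi 0))
    (h0 : ∫ r in Set.Ioi (0:ℝ), r^(a-1) * exp (-(1/2*r)) * K r = 0) :
    K 0 ≤ 0 ∧ ∀ τ, 0 < τ → ∫ r in (0:ℝ)..τ, r^(a-1) * exp (-(1/2*r)) * K r ≤ 0 := by
  constructor
  · by_contra hneg
    push Not at hneg
    have i1 := stein_integrable ha (φ := fun _ => K 0) (by fun_prop) (L := 0) (by simp)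
    have : ∫ r in Set.Ioi (0:ℝ), r^(a-1) * exp (-(1/2*r)) * K 0 ≤
        ∫ r in Set.Ioi (0:ℝ), r^(a-1) * exp (-(1/2*r)) * K r := by
      refine setIntegral_mono_on i1 hi measurableSet_Ioi fun r hr => ?_
      have hr : 0 < r := hr
      have := hK hr.le
      gcongr
    rw [h0, integral_mul_const, Real.integral_rpow_mul_exp_neg_mul_Ioi ha (by norm_num)] at this
    have hΓ := Real.Gamma_pos_of_pos ha
    have : 0 < (1/(1/2):ℝ)^a * Real.Gamma a * K 0 := by positivity
    linarith
  · intro τ hτ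
    rcases le_total (K τ) 0 with hk | hk
    · rw [intervalIntegral.integral_of_le hτ.le]
      refine setIntegral_nonpos measurableSet_Ioc fun r hr => ?_
      have := (hK hr.2).trans hk
      have hr := hr.1
      exact mul_nonpos_of_nonneg_of_nonpos (by positivity) this
    · have hsplit := intervalIntegral.integral_interval_add_Ioi hi
        (hi.mono_set (Set.Ioi_subset_Ioi hτ.le))
      have : 0 ≤ ∫ r in Set.Ioi τ, r^(a-1) * exp (-(1/2*r)) * K r := by
        refine setIntegral_nonneg measurableSet_Ioi fun r hr => ?_
        have hr : τ < r := hr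
        have h1 := hk.trans (hK hr.le)
        have := hτ.trans hr
        positivity
      linarith

lemma lipConst_spec {h : ℝ → ℝ} (hLip : ∃ K : NNReal, LipschitzWith K h) :
    0 ≤ lipConst h ∧ ∀ x y, |h y - h x| ≤ lipConst h * |y - x| := by
  obtain ⟨K, hK⟩ := hLip
  have hb : BddAbove {c | ∃ x y : ℝ, x ≠ y ∧ c = |h x - h y| / |x - y|} := by
    refine ⟨K, ?_⟩
    rintro c ⟨x, y, hxy, rfl⟩
    rw [div_le_iff₀ (abs_pos.2 (sub_ne_zero.2 hxy))]
    simpa [Real.dist_eq] using hK.dist_le_mul x y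
  constructor
  · exact (by positivity : 0 ≤ |h 0 - h 1| / |(0:ℝ) - 1|).trans
      (le_csSup hb ⟨0, 1, by norm_num, rfl⟩)
  · intro x y
    rcases eq_or_ne y x with rfl | hxy
    · simp
    · rw [← div_le_iff₀ (abs_pos.2 (sub_ne_zero.2 hxy))]
      exact le_csSup hb ⟨y, x, hxy, rfl⟩

lemma stein_upper {a L : ℝ} (ha : 0 < a) {H : ℝ → ℝ} (hHc : Continuous H)
    (hH : ∀ x y, |H y - H x| ≤ L * |y - x|)
    (h0 : ∫ r in Set.Ioi (0:ℝ), r^(a-1) * exp (-(1/2*r)) * H r = 0) :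
    (∀ τ, 0 < τ → steinG a (1/2) H τ ≤ L) ∧
    (∀ τ, 0 < τ → steinG a (-1/2) (fun r => H (-r)) τ ≤ L) ∧ H 0 ≤ L * (2*a) := by
  have hK : Monotone (fun t => H t + L * (2*(1/2)*t - 2*a)) := by
    intro x y hxy
    have := (abs_le.1 (hH x y)).1
    rw [abs_of_nonneg (sub_nonneg.2 hxy)] at this
    simp only
    linarith
  have hi1 := stein_integrable ha hHc hH
  have hi2 := stein_integrable ha (φ := fun r => 2*(1/2)*r - 2*a) (by fun_prop) (L := 1)
    (fun x y => by
      have : 2*(1/2)*y - 2*a - (2*(1/2)*x - 2*a) = y - x := by ring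
      rw [this]; simp)
  have he : ∀ r : ℝ, r^(a-1) * exp (-(1/2*r)) * (H r + L * (2*(1/2)*r - 2*a)) =
      r^(a-1) * exp (-(1/2*r)) * H r + L * (r^(a-1) * exp (-(1/2*r)) * (2*(1/2)*r - 2*a)) := by
    intro r; ring
  obtain ⟨k0, k1⟩ := stein_mono_nonpos ha hK
    (by simp_rw [he]; exact hi1.add (hi2.const_mul L))
    (by
      simp_rw [he]
      rw [integral_add hi1 (hi2.const_mul L), integral_const_mul, h0, stein_lin_zero ha]; simp)
  refine ⟨fun τ hτ => steinG_le ha _ hHc hτ (k1 τ hτ), fun τ hτ => steinG_le ha _ (by fun_prop) hτ ?_,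
    by linarith⟩
  rw [intervalIntegral.integral_of_le hτ.le]
  refine setIntegral_nonpos measurableSet_Ioc fun r hr => ?_
  have h1 := (hK (by linarith [hr.1] : -r ≤ 0)).trans k0
  have hr := hr.1
  refine mul_nonpos_of_nonneg_of_nonpos (by positivity) ?_
  simp only at h1
  linarith

lemma steinG_neg (a c : ℝ) (φ : ℝ → ℝ) (τ : ℝ) :
    steinG a c (fun r => - φ r) τ = - steinG a c φ τ := by
  simp [steinG]

lemma stein_bound {a L : ℝ} (ha : 0 < a) {H : ℝ → ℝ} (hHc : Continuous H)
    (hH : ∀ x y, |H y - H x| ≤ L * |y - x|)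
    (h0 : ∫ r in Set.Ioi (0:ℝ), r^(a-1) * exp (-(1/2*r)) * H r = 0) :
    (∀ τ, 0 < τ → |steinG a (1/2) H τ| ≤ L) ∧
    (∀ τ, 0 < τ → |steinG a (-1/2) (fun r => H (-r)) τ| ≤ L) ∧ |H 0| ≤ L * (2*a) := by
  obtain ⟨p1, p2, p3⟩ := stein_upper ha hHc hH h0
  obtain ⟨q1, q2, q3⟩ := stein_upper ha (H := fun r => - H r) hHc.neg (L := L)
    (fun x y => by
      have := hH x y
      rw [← abs_neg] at this
      convert this using 2; ring) (by simp only [mul_neg]; rw [integral_neg, h0, neg_zero])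
  refine ⟨fun τ hτ => ?_, fun τ hτ => ?_, ?_⟩
  · have := q1 τ hτ
    rw [steinG_neg] at this
    exact abs_le.2 ⟨by linarith, p1 τ hτ⟩
  · have := q2 τ hτ
    rw [steinG_neg] at this
    exact abs_le.2 ⟨by linarith, p2 τ hτ⟩
  · exact abs_le.2 ⟨by linarith, p3⟩

/-- Theorem `bounds2`(a): for `ν > 0` and Lipschitz `h : ℝ → ℝ` there is a
Lipschitz-continuous solution `f` on all of `ℝ` of the centered Gamma Stein equation
`2(x+ν) f'(x) − x f(x) = h(x) − E[h(Z_ν)]` (a Lipschitz function is locally absolutely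
continuous, and the equation is required at every point of differentiability), with
`sup_x |f x| ≤ ‖h'‖` and `‖f'‖ ≤ max(1, 2/ν) ‖h'‖`. -/
theorem centered_gamma_stein_solution_exists_lipschitz
    (ν : ℝ) (hν : 0 < ν)
    (h : ℝ → ℝ) (hLip : ∃ K : NNReal, LipschitzWith K h) :
    ∃ f : ℝ → ℝ,
      LipschitzWith (Real.toNNReal (max 1 (2 / ν) * lipConst h)) f ∧
      (∀ x : ℝ, DifferentiableAt ℝ f x →
        2 * (x + ν) * deriv f x - x * f x = h x - centeredGammaExp ν h) ∧
      (∀ x : ℝ, |f x| ≤ lipConst h) := by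
  have hhc : Continuous h := by obtain ⟨K, hK⟩ := hLip; exact hK.continuous
  obtain ⟨hL, hh⟩ := lipConst_spec hLip
  generalize lipConst h = L at *
  obtain ⟨E, hE⟩ : ∃ E, E = centeredGammaExp ν h := ⟨_, rfl⟩
  have ha : 0 < ν/2 := by positivity
  obtain ⟨H, hHd⟩ : ∃ H : ℝ → ℝ, H = fun t => h (t - ν) - E := ⟨_, rfl⟩
  have hHc : Continuous H := by rw [hHd]; fun_prop
  have hH : ∀ x y, |H y - H x| ≤ L * |y - x| := by
    intro x y
    have := hh (x - ν) (y - ν)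
    rw [hHd]
    simpa using this
  have h0 : ∫ r in Set.Ioi (0:ℝ), r^(ν/2-1) * exp (-(1/2*r)) * H r = 0 := by
    have i1 := stein_integrable ha (φ := fun r => h (r - ν)) (by fun_prop) (L := L)
      (fun x y => by simpa using hh (x - ν) (y - ν))
    have i2 := stein_integrable ha (φ := fun _ => E) (by fun_prop) (L := 0) (by simp)
    have : ∀ r : ℝ, r^(ν/2-1) * exp (-(1/2*r)) * H r =
      r^(ν/2-1) * exp (-(1/2*r)) * h (r - ν) - r^(ν/2-1) * exp (-(1/2*r)) * E := by
      intro r; rw [hHd]; ring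
    simp_rw [this]
    rw [integral_sub i1 i2, stein_mean hν, integral_mul_const, hE]
    ring
  obtain ⟨b1, b2, b3⟩ := stein_bound ha hHc hH h0
  have hMpos : 1 ≤ max 1 (2/ν) := le_max_left _ _
  have hm : 1 / min (ν/2) 1 = max 1 (2/ν) := by
    rcases le_total (ν/2) 1 with hc | hc
    · rw [min_eq_left hc, max_eq_right]
      · field_simp
      · rw [le_div_iff₀ hν]; linarith
    · rw [min_eq_right hc, max_eq_left]
      · simp
      · rw [div_le_iff₀ hν]; linarith
  have hHc' : Continuous (fun r => H (-r)) := by fun_prop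
  have hH' : ∀ x y, |H (-y) - H (-x)| ≤ L * |y - x| := by
    intro x y
    refine (hH (-x) (-y)).trans (le_of_eq ?_)
    rw [← abs_neg]; congr 2; ring
  have dp := fun x (hx : 0 < x) => steinG_deriv ha (1/2) hHc hx
  have dn := fun x (hx : 0 < x) => steinG_deriv ha (-1/2) hHc' hx
  have rp := fun x (hx : 0 < x) => steinR_pos ha hHc hH hL dp b1 (m := min (ν/2) 1)
    (lt_min ha one_pos) (min_le_right _ _) (min_le_left _ _) hx
  rw [hm] at rp
  have rn := fun x (hx : 0 < x) => steinR_neg ha hHc' hH' hL dn b2 hMpos hx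
  obtain ⟨lp, zp⟩ := stein_glue ha hHc dp b1 rp
  obtain ⟨ln, zn⟩ := stein_glue ha hHc' dn b2 rn
  generalize hMM : max 1 (2/ν) = M at *
  obtain ⟨C, hC⟩ : ∃ C, C = M * L := ⟨_, rfl⟩
  rw [← hC] at lp zp ln zn ⊢
  have hC0 : 0 ≤ C := by rw [hC]; positivity
  have h2a : 2 * (ν/2) = ν := by ring
  simp only [h2a, neg_zero] at zp zn b3
  obtain ⟨g, hg⟩ : ∃ g : ℝ → ℝ, g = fun t => if 0 < t then steinG (ν/2) (1/2) H t
    else if t < 0 then steinG (ν/2) (-1/2) (fun r => H (-r)) (-t) else H 0 / ν := ⟨_, rfl⟩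
  have gp : ∀ t, 0 < t → g t = steinG (ν/2) (1/2) H t := fun t ht => by rw [hg]; simp [ht]
  have gn : ∀ t, t < 0 → g t = steinG (ν/2) (-1/2) (fun r => H (-r)) (-t) := fun t ht => by
    rw [hg]; simp [ht, ht.le]
  have g0 : g 0 = H 0 / ν := by rw [hg]; simp
  have key : ∀ s t, s ≤ t → |g t - g s| ≤ C * (t - s) := by
    intro s t hst
    have zz : ∀ t, |g t - g 0| ≤ C * |t| := by
      intro t
      rcases lt_trichotomy t 0 with ht | ht | ht
      · rw [gn t ht, g0, abs_of_neg ht]; exact zn _ (by linarith)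
      · subst ht; simp
      · rw [gp t ht, g0, abs_of_pos ht]; exact zp _ ht
    rcases lt_or_ge 0 s with hs | hs
    · have ht := hs.trans_le hst
      rw [gp t ht, gp s hs]
      refine (lp t s ht hs).trans (le_of_eq ?_)
      rw [abs_of_nonneg (by linarith)]
    · rcases lt_or_ge t 0 with ht | ht
      · have hs' := hst.trans_lt ht
        rw [gn t ht, gn s hs']
        refine (ln (-t) (-s) (by linarith) (by linarith)).trans (le_of_eq ?_)
        rw [abs_of_nonpos (by linarith)]; ring
      · have z1 := zz t
        have z2 := zz s
        rw [abs_of_nonneg ht] at z1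
        rw [abs_of_nonpos hs, abs_sub_comm] at z2
        have := abs_sub_le (g t) (g 0) (g s)
        linarith
  refine ⟨fun x => g (x + ν), ?_, ?_, ?_⟩
  · refine LipschitzWith.of_dist_le_mul fun x y => ?_
    rw [Real.coe_toNNReal _ hC0, Real.dist_eq, Real.dist_eq]
    rcases le_total x y with hxy | hxy
    · rw [abs_sub_comm, abs_sub_comm x y, abs_of_nonneg (sub_nonneg.2 hxy)]
      have := key (x + ν) (y + ν) (by linarith)
      rwa [add_sub_add_right_eq_sub] at this
    · rw [abs_of_nonneg (sub_nonneg.2 hxy)]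
      have := key (y + ν) (x + ν) (by linarith)
      rwa [add_sub_add_right_eq_sub] at this
  · intro x _
    have hHx : h x - centeredGammaExp ν h = H (x + ν) := by rw [hHd, hE]; simp
    rw [hHx, deriv_comp_add_const]
    obtain ⟨t, ht⟩ : ∃ t, t = x + ν := ⟨_, rfl⟩
    have hx : x = t - ν := by linarith
    rw [← ht, hx]
    simp only [sub_add_cancel]
    rcases lt_trichotomy t 0 with h1 | h1 | h1
    · have d1 := dn (-t) (by linarith)
      have d2 := d1.comp t (hasDerivAt_neg t)
      have d3 : HasDerivAt g _ t := d2.congr_of_eventuallyEq (by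
        filter_upwards [Iio_mem_nhds h1] with s hs
        exact gn s hs)
      rw [d3.deriv, gn t h1]
      have : t ≠ 0 := h1.ne
      rw [neg_neg]
      field_simp
      ring
    · subst h1
      rw [g0]; field_simp; ring
    · have d3 : HasDerivAt g _ t := (dp t h1).congr_of_eventuallyEq (by
        filter_upwards [Ioi_mem_nhds h1] with s hs
        exact gp s hs)
      rw [d3.deriv, gp t h1]
      field_simp
      ring
  · intro x
    show |g (x + ν)| ≤ L
    rcases lt_trichotomy (x + ν) 0 with h1 | h1 | h1
    · rw [gn _ h1]; exact b2 _ (by linarith)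
    · rw [h1, g0, abs_div, abs_of_pos hν, div_le_iff₀ hν]; exact b3
    · rw [gp _ h1]; exact b1 _ h1
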